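/- Let G be the free product of groups H_1 and H_2 amalgamated over a common subgroup K, where K is a proper subgroup of H_1 and a proper subgroup of H_2, and identify H_1, H_2, K with their images in G. Then Z(G) = Z(H_1) ∩ Z(H_2), and in particular Z(G) ⊆ K. -/

import Mathlib

/-- A labelled graph: a vertex set `V` and a symmetric labelling `m : V → V → ℕ∞`
with `m u v ≥ 2` for `u ≠ v` (`m u v = ∞` means no edge). -/
structure LabelledGraph (V : Type*) where
  m : V → V → ℕ∞
  symm : ∀ u v, m u v = m v u
  two_le : ∀ u v, u ≠ v → 2 ≤ m u v

namespace LabelledGraph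

variable {V W : Type*}

/-- The alternating product `x * y * x * ⋯` with `n` terms. -/
def altProd {G : Type*} [Monoid G] (x y : G) : ℕ → G
  | 0 => 1
  | n + 1 => x * altProd y x n

/-- The alternating word `u v u v ⋯` with `n` terms in the free group. -/
def altWord (u v : V) (n : ℕ) : FreeGroup V :=
  altProd (FreeGroup.of u) (FreeGroup.of v) n

/-- The Artin relations of a labelled graph: for each `u ≠ v` with finite label
`m u v = k`, the relation `(u v u ⋯) = (v u v ⋯)` (both sides with `k` terms). -/
def artinRels (Γ : LabelledGraph V) : Set (FreeGroup V) :=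
  { r | ∃ (u v : V) (k : ℕ), u ≠ v ∧ Γ.m u v = (k : ℕ∞) ∧
        r = altWord u v k * (altWord v u k)⁻¹ }

/-- The Artin group of a labelled graph. -/
abbrev ArtinGroup (Γ : LabelledGraph V) : Type _ := PresentedGroup Γ.artinRels

/-- The standard generators of an Artin group. -/
def σ (Γ : LabelledGraph V) (v : V) : Γ.ArtinGroup := PresentedGroup.of v

/-- The special subgroup of the Artin group generated by `{σ v : v ∈ K}`. -/
def specialSubgroup (Γ : LabelledGraph V) (K : Set V) : Subgroup Γ.ArtinGroup :=
  Subgroup.closure (Γ.σ '' K)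

/-- A cone point of `Γ`: a vertex `t` with `m t v < ∞` for every `v ≠ t`. -/
def IsConePoint (Γ : LabelledGraph V) (t : V) : Prop :=
  ∀ v : V, v ≠ t → Γ.m t v ≠ ⊤

/-- The induced labelled subgraph on a subset `K` of the vertices. -/
def induce (Γ : LabelledGraph V) (K : Set V) : LabelledGraph K where
  m u v := Γ.m u v
  symm u v := Γ.symm u v
  two_le u v h := Γ.two_le u v (fun e => h (Subtype.ext e))

/-- `Γ` is irreducible if its vertex set admits no partition into two nonempty sets
with all labels between the two parts equal to `2`. -/
def Irreducible (Γ : LabelledGraph V) : Prop :=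
  ¬ ∃ V₁ V₂ : Set V, V₁.Nonempty ∧ V₂.Nonempty ∧ Disjoint V₁ V₂ ∧ V₁ ∪ V₂ = Set.univ ∧
      ∀ u ∈ V₁, ∀ v ∈ V₂, Γ.m u v = 2

/-- The square relations `σ_v² = 1` defining the Coxeter quotient. -/
def squareRels (V : Type*) : Set (FreeGroup V) :=
  Set.range fun v : V => FreeGroup.of v * FreeGroup.of v

/-- The Coxeter group of a labelled graph: the quotient of the Artin group obtained
by adding the relations `σ_v² = 1`. -/
abbrev CoxeterGroupOf (Γ : LabelledGraph V) : Type _ :=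
  PresentedGroup (Γ.artinRels ∪ squareRels V)

/-- `Γ` is spherical if its Coxeter group is finite. -/
def Spherical (Γ : LabelledGraph V) : Prop := Finite Γ.CoxeterGroupOf

/-- The natural surjection `θ` from the Artin group to the Coxeter group. -/
def artinToCoxeter (Γ : LabelledGraph V) : Γ.ArtinGroup →* Γ.CoxeterGroupOf :=
  QuotientGroup.map _ _ (MonoidHom.id _)
    (by
      intro x hx
      simpa using Subgroup.normalClosure_mono (Set.subset_union_left (t := squareRels V)) hx)

/-- The pure Artin group: the kernel of the natural surjection to the Coxeter group. -/
def pureArtinGroup (Γ : LabelledGraph V) : Subgroup Γ.ArtinGroup :=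
  (artinToCoxeter Γ).ker

/-- `P : Fin n → Set V` is a decomposition of `Γ` as a `2`-labelled join of
irreducible induced subgraphs. -/
def IsIrredDecomp (Γ : LabelledGraph V) (n : ℕ) (P : Fin n → Set V) : Prop :=
  (∀ i, (P i).Nonempty) ∧
  (⋃ i, P i) = Set.univ ∧
  (∀ i j, i ≠ j → Disjoint (P i) (P j)) ∧
  (∀ i j, i ≠ j → ∀ u ∈ P i, ∀ v ∈ P j, Γ.m u v = 2) ∧
  (∀ i, (Γ.induce (P i)).Irreducible)

/-- `Γ` satisfies the Center Conjecture if for the (finest) decomposition of `Γ` as a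
`2`-labelled join of irreducible induced subgraphs `Γ₁, …, Γₙ`, the center of the Artin
group `A_Γ` is free abelian of rank the number of spherical factors `Γᵢ`. -/
def SatisfiesCenterConjecture (Γ : LabelledGraph V) : Prop :=
  ∀ (n : ℕ) (P : Fin n → Set V), Γ.IsIrredDecomp n P →
    Nonempty ((Subgroup.center Γ.ArtinGroup) ≃*
      Multiplicative (Fin (Nat.card {i : Fin n // (Γ.induce (P i)).Spherical}) → ℤ))

/-- A monoid hom applied to an alternating product. -/
theorem map_altProd {G H : Type*} [Monoid G] [Monoid H] (φ : G →* H) (x y : G) (n : ℕ) :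
    φ (altProd x y n) = altProd (φ x) (φ y) n := by
  induction n generalizing x y with
  | zero => simp [altProd]
  | succ n ih => simp [altProd, ih]

/-- The homomorphism between Artin groups induced by a label-preserving injection of
labelled graphs, sending generators to generators. -/
def mapHom (Γ : LabelledGraph V) (Δ : LabelledGraph W) (f : V → W)
    (hf : ∀ u v : V, u ≠ v → f u ≠ f v)
    (hm : ∀ u v : V, Γ.m u v = Δ.m (f u) (f v)) :
    Γ.ArtinGroup →* Δ.ArtinGroup :=
  PresentedGroup.toGroup (f := fun v => Δ.σ (f v))
    (by
      rintro r ⟨u, v, k, huv, hk, rfl⟩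
      have key : ∀ (a b : V),
          FreeGroup.lift (fun v => Δ.σ (f v)) (altWord a b k)
            = PresentedGroup.mk Δ.artinRels (altWord (f a) (f b) k) := by
        intro a b
        rw [altWord, map_altProd, altWord, map_altProd]
        simp [σ, PresentedGroup.of]
      rw [map_mul, map_inv, key, key, ← map_inv, ← map_mul]
      refine (QuotientGroup.eq_one_iff _).mpr (Subgroup.subset_normalClosure ?_)
      exact ⟨f u, f v, k, hf u v huv, (hm u v) ▸ hk, rfl⟩)

@[simp]
theorem mapHom_σ (Γ : LabelledGraph V) (Δ : LabelledGraph W) (f : V → W)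
    (hf : ∀ u v : V, u ≠ v → f u ≠ f v)
    (hm : ∀ u v : V, Γ.m u v = Δ.m (f u) (f v)) (v : V) :
    mapHom Γ Δ f hf hm (Γ.σ v) = Δ.σ (f v) :=
  PresentedGroup.toGroup.of _

/-- The homomorphism between the Artin groups of induced subgraphs coming from an
inclusion `K' ⊆ K`. -/
def induceHom (Γ : LabelledGraph V) {K' K : Set V} (h : K' ⊆ K) :
    (Γ.induce K').ArtinGroup →* (Γ.induce K).ArtinGroup :=
  mapHom _ _ (Set.inclusion h)
    (fun _ _ huv e => huv (Set.inclusion_injective h e))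
    (fun _ _ => rfl)

/-- The homomorphism from the Artin group of an induced subgraph to the ambient
Artin group. -/
def inclHom (Γ : LabelledGraph V) (K : Set V) :
    (Γ.induce K).ArtinGroup →* Γ.ArtinGroup :=
  mapHom _ _ Subtype.val
    (fun _ _ huv e => huv (Subtype.ext e))
    (fun _ _ => rfl)

end LabelledGraph

namespace Monoid.PushoutI

variable {ι : Type*} {G : ι → Type*} {K : Type*} [∀ i, Group (G i)] [Group K]
  {φ : ∀ i, K →* G i}

/-- The product in the pushout of a list of letters. -/
def listProd (φ : ∀ i, K →* G i) (l : List (Σ i, G i)) : PushoutI φ :=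
  (l.map fun x => of x.1 x.2).prod

/-- A list of letters is reduced if no letter lies in the amalgamated subgroup and adjacent
letters come from different factors. -/
def IsReducedList (φ : ∀ i, K →* G i) (l : List (Σ i, G i)) : Prop :=
  (∀ x ∈ l, x.2 ∉ (φ x.1).range) ∧ l.IsChain fun x y => x.1 ≠ y.1

/-- Reduced lists with the same product have the same sequence of factors. -/
theorem IsReducedList.map_fst_eq (hφ : ∀ i, Function.Injective (φ i)) {l l' : List (Σ i, G i)}
    (hl : IsReducedList φ l) (hl' : IsReducedList φ l') (h : listProd φ l = listProd φ l') :
    l.map Sigma.fst = l'.map Sigma.fst := by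
  obtain ⟨d⟩ := NormalWord.transversal_nonempty φ hφ
  have normalWord {m : List (Σ i, G i)} (hm : IsReducedList φ m) :
      ∃ w : NormalWord d, w.prod = listProd φ m ∧ w.toList.map Sigma.fst = m.map Sigma.fst := by
    obtain ⟨w, hw, hw'⟩ := Reduced.exists_normalWord_prod_eq d
      (w := ⟨m, fun x hx h1 => hm.1 x hx (h1 ▸ one_mem _), hm.2⟩) hm.1
    refine ⟨w, ?_, hw'⟩
    simp [hw, CoprodI.Word.prod, listProd, map_list_prod, Function.comp_def]
  obtain ⟨w, hw, hwl⟩ := normalWord hl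
  obtain ⟨w', hw', hwl'⟩ := normalWord hl'
  rw [← hwl, ← hwl', NormalWord.prod_injective (hw.trans (h.trans hw'.symm))]

theorem NormalWord.Transversal.notMem_range {d : Transversal φ} {i : ι} {g : G i}
    (hg : g ∈ d.set i) (h1 : g ≠ 1) : g ∉ (φ i).range := fun hr =>
  h1 <| by
    have := (d.compl i).1 (a₁ := (⟨g, hr⟩, ⟨1, d.one_mem i⟩)) (a₂ := (1, ⟨g, hg⟩)) (by simp)
    simpa using congrArg (fun p => (p.1 : G i)) this

/-- Every element outside the amalgamated subgroup is the product of a nonempty reduced list. -/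
theorem exists_isReducedList_cons (hφ : ∀ i, Function.Injective (φ i)) {z : PushoutI φ}
    (hz : z ∉ (base φ).range) : ∃ x l, IsReducedList φ (x :: l) ∧ listProd φ (x :: l) = z := by
  classical
  obtain ⟨d⟩ := NormalWord.transversal_nonempty φ hφ
  obtain ⟨⟨⟨l, hne, hchain⟩, k, hnorm⟩, rfl⟩ := (NormalWord.equiv (d := d)).symm.surjective z
  cases l with
  | nil => exact absurd ⟨k, by simp [NormalWord.equiv, NormalWord.prod, CoprodI.Word.prod]⟩ hz
  | cons x l =>
    have hred : ∀ y ∈ x :: l, y.2 ∉ (φ y.1).range := fun y hy =>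
      NormalWord.Transversal.notMem_range (hnorm y.1 y.2 hy) (hne y hy)
    refine ⟨⟨x.1, φ x.1 k * x.2⟩, l, ⟨?_, ?_⟩, ?_⟩
    · intro y hy
      rcases List.mem_cons.1 hy with rfl | hy
      · exact fun h => hred x List.mem_cons_self
          ((Subgroup.mul_mem_cancel_left _ (MonoidHom.mem_range.2 ⟨k, rfl⟩)).1 h)
      · exact hred y (List.mem_cons_of_mem _ hy)
    · cases l with
      | nil => exact List.isChain_singleton _
      | cons y l => exact List.isChain_cons_cons.2 (List.isChain_cons_cons.1 hchain)
    · simp [NormalWord.equiv, NormalWord.prod, CoprodI.Word.prod, listProd, map_list_prod,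
        Function.comp_def, of_apply_eq_base, mul_assoc]

/-- The center of an amalgamated product of at least two groups, each properly containing the
amalgamated subgroup, lies in the amalgamated subgroup. -/
theorem center_le_base_range [Nontrivial ι] (hφ : ∀ i, Function.Injective (φ i))
    (hproper : ∀ i, (φ i).range ≠ ⊤) :
    Subgroup.center (PushoutI φ) ≤ (base φ).range := by
  intro z hz
  by_contra hzb
  obtain ⟨⟨i, g⟩, l, hred, rfl⟩ := exists_isReducedList_cons hφ hzb
  have hcomm := Subgroup.mem_center_iff.1 hz
  have head_ne {a b : Σ i, G i} {m n : List (Σ i, G i)} (hab : a.1 ≠ b.1)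
      (ha : IsReducedList φ (a :: m)) (hb : IsReducedList φ (b :: n)) :
      listProd φ (a :: m) ≠ listProd φ (b :: n) := fun h =>
    hab (List.cons.inj (ha.map_fst_eq hφ hb h)).1
  by_cases hlast : ∀ y ∈ (⟨i, g⟩ :: l : List (Σ i, G i)).getLast?, y.1 = i
  · obtain ⟨j, hji⟩ := exists_ne i
    obtain ⟨h, hh⟩ : ∃ h, h ∉ (φ j).range := by
      simpa [Subgroup.eq_top_iff'] using hproper j
    have hcons : IsReducedList φ (⟨j, h⟩ :: ⟨i, g⟩ :: l) :=
      ⟨List.forall_mem_cons.2 ⟨hh, hred.1⟩, List.isChain_cons_cons.2 ⟨hji, hred.2⟩⟩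
    have hsnoc : IsReducedList φ (⟨i, g⟩ :: (l ++ [⟨j, h⟩])) := by
      rw [← List.cons_append]
      refine ⟨List.forall_mem_append.2 ⟨hred.1, by simpa using hh⟩,
        List.isChain_append.2 ⟨hred.2, List.isChain_singleton _, ?_⟩⟩
      simpa using fun y hy => (hlast y hy).trans_ne hji.symm
    refine head_ne hji hcons hsnoc ?_
    simpa [listProd, mul_assoc] using hcomm (of j h)
  · cases l with
    | nil => simp at hlast
    | cons x l =>
      have hchain := List.isChain_cons_cons.1 hred.2
      have hsnoc : IsReducedList φ (x :: (l ++ [⟨i, g⟩])) := by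
        rw [← List.cons_append]
        refine ⟨List.forall_mem_append.2 ⟨fun y hy => hred.1 y (List.mem_cons_of_mem _ hy),
          by simpa using hred.1 _ List.mem_cons_self⟩,
          List.isChain_append.2 ⟨hchain.2, List.isChain_singleton _, ?_⟩⟩
        intro y hy w hw
        obtain rfl : ⟨i, g⟩ = w := by simpa using hw
        rintro rfl
        refine hlast fun u hu => ?_
        rw [List.getLast?_cons_cons] at hu
        rw [Option.mem_unique hu hy]
      refine head_ne hchain.1 hred hsnoc ?_
      simpa [listProd, mul_assoc] using hcomm (of i g)

/-- An element of the amalgamated subgroup that is central in the pushout is central in each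
factor. -/
theorem mem_center_of_base_mem_center (hφ : ∀ i, Function.Injective (φ i)) {k : K}
    (hk : base φ k ∈ Subgroup.center (PushoutI φ)) (i : ι) :
    φ i k ∈ Subgroup.center (G i) :=
  Subgroup.mem_center_iff.2 fun g => of_injective hφ i <| by
    simpa [of_apply_eq_base] using Subgroup.mem_center_iff.1 hk (of i g)

/-- An element lying in the image of the center of every factor is central. -/
theorem iInf_map_center_le_center [Nonempty ι] :
    ⨅ i, (Subgroup.center (G i)).map (of (φ := φ) i) ≤ Subgroup.center (PushoutI φ) := by
  intro z hz
  have hof (i : ι) (g : G i) : of i g * z = z * of i g := by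
    obtain ⟨x, hx, rfl⟩ := Subgroup.mem_iInf.1 hz i
    rw [← map_mul, ← map_mul, Subgroup.mem_center_iff.1 hx]
  refine Subgroup.mem_center_iff.2 fun y => ?_
  induction y using induction_on with
  | of i g => exact hof i g
  | base k =>
    rw [← of_apply_eq_base φ (Classical.arbitrary ι)]
    exact hof _ _
  | mul x y hx hy => rw [mul_assoc, hy, ← mul_assoc, hx, mul_assoc]

/-- The center of an amalgamated product of at least two groups, each properly containing the
amalgamated subgroup, is the intersection of the centers of the factors. -/
theorem center_eq_iInf [Nontrivial ι] (hφ : ∀ i, Function.Injective (φ i))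
    (hproper : ∀ i, (φ i).range ≠ ⊤) :
    Subgroup.center (PushoutI φ) = ⨅ i, (Subgroup.center (G i)).map (of (φ := φ) i) := by
  refine le_antisymm (le_iInf fun i z hz => ?_) iInf_map_center_le_center
  obtain ⟨k, rfl⟩ := center_le_base_range hφ hproper hz
  exact ⟨φ i k, mem_center_of_base_mem_center hφ hz i, of_apply_eq_base φ i k⟩

end Monoid.PushoutI

/-- Let `G = H₁ *_K H₂` be the free product of `H₁` and `H₂`
amalgamated over a common subgroup `K` (given by injective homomorphisms with proper
images), and identify `H₁`, `H₂`, `K` with their images in `G`.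
Then `Z(G) = Z(H₁) ∩ Z(H₂)`, and in particular `Z(G) ⊆ K`. -/
theorem center_amalgamated_product {K : Type*} [Group K] {H : Bool → Type*}
    [∀ b, Group (H b)] (φ : ∀ b, K →* H b)
    (hinj : ∀ b, Function.Injective (φ b))
    (hproper : ∀ b, (φ b).range ≠ ⊤) :
    Subgroup.center (Monoid.PushoutI φ) =
      (Subgroup.center (H true)).map (Monoid.PushoutI.of (φ := φ) true) ⊓
        (Subgroup.center (H false)).map (Monoid.PushoutI.of (φ := φ) false) ∧
    Subgroup.center (Monoid.PushoutI φ) ≤ (Monoid.PushoutI.base φ).range := by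
  have hcenter := Monoid.PushoutI.center_eq_iInf hinj hproper
  rw [iInf_bool_eq] at hcenter
  exact ⟨hcenter, Monoid.PushoutI.center_le_base_range hinj hproper⟩
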